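/- With S a paracell in X, S' its opposite, and I_1,...,I_N an enumeration of S', one has U_S = (1−Î_1)···(1−Î_N) in A(X), where U_S = Σ_ν Σ_{chains} (−1)^{ν−1}{J_1,...,J_ν} is the alternating sum over all chains associated to S'. -/

import Mathlib

open scoped Classical

namespace GRF

variable {α : Type*} [DecidableEq α]

/-- `J` is a proper (nonempty, not everything) subset of `X`. -/
def IsProperSubset (X J : Finset α) : Prop := J ⊆ X ∧ J ≠ ∅ ∧ J ≠ X

/-- A proper sequence in `P(X)`: a nonempty list of pairwise disjoint nonempty
subsets of `X` with union `X`. -/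
def IsProperSeq (X : Finset α) (c : List (Finset α)) : Prop :=
  c ≠ [] ∧ (∀ J ∈ c, J ≠ ∅) ∧ List.Pairwise (fun I J => I ∩ J = ∅) c ∧
    c.foldr (· ∪ ·) ∅ = X

/-- The product of two sequences: all `A_i ∩ B_j`, ordered first by `j` then by `i`,
with empty intersections deleted. -/
noncomputable def seqMul (a b : List (Finset α)) : List (Finset α) :=
  ((b.map fun B => a.map fun A => A ∩ B).flatten).filter fun J => J ≠ ∅

/-- The set `S' = {J ⊆ X : X \ J ∈ S}` opposite to `S`. -/
def opp (X : Finset α) (S : Set (Finset α)) : Set (Finset α) :=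
  {J | J ⊆ X ∧ X \ J ∈ S}

/-- A paracell associated to `X`. -/
def IsParacell (X : Finset α) (S : Set (Finset α)) : Prop :=
  S.Nonempty ∧ (∀ J ∈ S, IsProperSubset X J) ∧
    ∀ I ∈ S, ∀ J ∈ S, I ∩ J ∈ S ∨ I ∪ J ∈ S

/-- A precell associated to `X`. -/
def IsPrecell (X : Finset α) (S : Set (Finset α)) : Prop :=
  IsParacell X S ∧ ∀ J : Finset α, IsProperSubset X J → J ∈ S ∨ X \ J ∈ S

/-- A cell associated to `X`: a precell admitting real weights with zero total sum,
positive on all members of the cell. -/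
def IsCell (X : Finset α) (S : Set (Finset α)) : Prop :=
  IsPrecell X S ∧ ∃ s : α → ℝ,
    (∑ j ∈ X, s j) = 0 ∧ ∀ J ∈ S, 0 < ∑ j ∈ J, s j

/-- `Y ↓ S` for `S` a paracell associated to `X`. -/
def cellDown (Y X : Finset α) (S : Set (Finset α)) : Set (Finset α) :=
  {J | IsProperSubset (Y ∪ X) J ∧ (J ∩ X = X ∨ J ∩ X ∈ S)}

/-- `Y ↑ S'` for `S'` a paracell associated to `X`. -/
def cellUp (Y X : Finset α) (S : Set (Finset α)) : Set (Finset α) :=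
  {J | IsProperSubset (Y ∪ X) J ∧ (J ∩ X = ∅ ∨ J ∩ X ∈ S)}

/-- `Y ↓ j` for a single index `j`. -/
def ptDown (Y : Finset α) (j : α) : Set (Finset α) :=
  {J | IsProperSubset (insert j Y) J ∧ j ∈ J}

/-- `Y ↑ j` for a single index `j`. -/
def ptUp (Y : Finset α) (j : α) : Set (Finset α) :=
  {J | IsProperSubset (insert j Y) J ∧ j ∉ J}

/-- The underlying vector space of the algebra `A(X)`: formal complex linear
combinations of sequences of subsets. -/
abbrev AX (α : Type*) [DecidableEq α] : Type _ := (List (Finset α)) →₀ ℂ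

/-- The multiplication of `A(X)`, extending `seqMul` bilinearly. -/
noncomputable def amul (x y : AX α) : AX α :=
  x.sum fun a ca => y.sum fun b cb => Finsupp.single (seqMul a b) (ca * cb)

/-- The unit `{X}` of `A(X)`. -/
noncomputable def oneA (X : Finset α) : AX α := Finsupp.single [X] 1

/-- `Î = {I, X \ I}` as an element of `A(X)`. -/
noncomputable def hatI (X I : Finset α) : AX α := Finsupp.single [I, X \ I] 1

/-- Product of a list of elements of `A(X)` (with unit `{X}`). -/
noncomputable def aprod (X : Finset α) (l : List (AX α)) : AX α :=
  l.foldr amul (oneA X)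

/-- A `ν`-chain associated to `S'`: a proper sequence all of whose proper initial
partial unions lie in `S'`. -/
def IsChainFor (X : Finset α) (S' : Set (Finset α)) (c : List (Finset α)) : Prop :=
  IsProperSeq X c ∧
    ∀ r : ℕ, 0 < r → r < c.length → ((c.take r).foldr (· ∪ ·) ∅) ∈ S'

lemma IsProperSeq.nodup {X : Finset α} {c : List (Finset α)}
    (h : IsProperSeq X c) : c.Nodup := by
  obtain ⟨-, hne, hpw, -⟩ := h
  refine List.Pairwise.imp_of_mem ?_ hpw
  intro a b ha _ hab
  intro h'
  subst h'
  exact hne a ha (by simpa using hab)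

/-- `U_S = Σ_ν Σ_{ν-chains for S'} (−1)^{ν−1} {J_1,…,J_ν}`, as a function of the
opposite paracell `S'`. -/
noncomputable def US [Fintype α] (X : Finset α) (S' : Set (Finset α)) : AX α :=
  Finsupp.ofSupportFinite
    (fun c => if IsChainFor X S' c then (-1 : ℂ) ^ (c.length - 1) else 0)
    (Set.Finite.subset
      (List.finite_length_le (Finset α) (Fintype.card (Finset α)))
      (by
        intro c hc
        have h : IsChainFor X S' c := by
          by_contra h
          simp [Function.mem_support, h] at hc
        exact h.1.nodup.length_le_card))

/-- The underlying vector space of `A(A∪{1}) ⊗ A(B∪{1})`. -/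
abbrev AX2 (α : Type*) [DecidableEq α] : Type _ :=
  (List (Finset α) × List (Finset α)) →₀ ℂ

/-- The multiplication of the tensor product algebra. -/
noncomputable def tmul (x y : AX2 α) : AX2 α :=
  x.sum fun a ca => y.sum fun b cb =>
    Finsupp.single (seqMul a.1 b.1, seqMul a.2 b.2) (ca * cb)

/-- The tensor `u ⊗ v` of two elements of `A(A∪{1})` and `A(B∪{1})`. -/
noncomputable def tens (u v : AX α) : AX2 α :=
  u.sum fun a ca => v.sum fun b cb => Finsupp.single (a, b) (ca * cb)

/-- The pair `(c_A, c_B)` of traces of a sequence `c` on `A∪{1}` and `B∪{1}`,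
with empty sets deleted. -/
noncomputable def facSeq (A1 B1 : Finset α) (c : List (Finset α)) :
    List (Finset α) × List (Finset α) :=
  ((c.map fun J => J ∩ A1).filter fun J => J ≠ ∅,
   (c.map fun J => J ∩ B1).filter fun J => J ≠ ∅)

/-- The factorization map `Fac : A(X) → A(A∪{1}) ⊗ A(B∪{1})`. -/
noncomputable def Fac (A1 B1 : Finset α) (x : AX α) : AX2 α :=
  x.sum fun c cc => Finsupp.single (facSeq A1 B1 c) cc

/-- The paracell `(S‖1,A)` built from opposite paracells `S`, `S'` relative to
`X = A ∪ B ∪ {o}`. -/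
def restCell (A : Finset α) (o : α) (S S' : Set (Finset α)) : Set (Finset α) :=
  {J | IsProperSubset (insert o A) J ∧
    ((J ⊆ A ∧ J ∈ S) ∨ (o ∈ J ∧ A \ J ∈ S'))}


/-- Refinement of a sequence by `I`. -/
noncomputable def refi (I : Finset α) : List (Finset α) → List (Finset α)
  | [] => []
  | J :: t => ([J ∩ I, J \ I].filter fun J => J ≠ ∅) ++ refi I t

/-- Recursive form of the chain condition, starting from the partial union `K`. -/
def Ch (X : Finset α) (T : Set (Finset α)) : Finset α → List (Finset α) → Prop
  | K, [] => K = X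
  | K, J :: t => J ≠ ∅ ∧ K ∩ J = ∅ ∧ (K ∪ J ∈ T ∨ K ∪ J = X) ∧ Ch X T (K ∪ J) t

/-- The merging condition: first block inside `I`, next block disjoint from `I`. -/
def MergeC (I J : Finset α) : List (Finset α) → Prop
  | [] => False
  | J' :: _ => J ⊆ I ∧ J' ∩ I = ∅

/-- The sign-reversing involution. -/
noncomputable def tog (T : Set (Finset α)) (I : Finset α) :
    Finset α → List (Finset α) → List (Finset α)
  | _, [] => []
  | K, J :: t =>
    if J ∩ I ≠ ∅ ∧ J \ I ≠ ∅ ∧ K ∪ (J ∩ I) ∈ T then (J ∩ I) :: (J \ I) :: t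
    else if MergeC I J t ∧ K ∪ J ∈ T then (J ∪ t.headD ∅) :: t.tail
    else J :: tog T I (K ∪ J) t

lemma seqMul_eq_refi (X I : Finset α) (c : List (Finset α)) (hc : ∀ J ∈ c, J ⊆ X) :
    seqMul [I, X \ I] c = refi I c := by
  induction c with
  | nil => simp [seqMul, refi]
  | cons J t ih =>
    have h1 : (X \ I) ∩ J = J \ I := by
      have := hc J (by simp)
      ext x; have := @this x; simp; tauto
    have ih := ih (fun J hJ => hc J (by simp [hJ]))
    unfold seqMul at ih ⊢
    rw [refi, ← ih]
    simp only [List.map_cons, List.flatten_cons, List.filter_append, h1, Finset.inter_comm I J,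
      List.map_nil]

lemma seqMul_one (X : Finset α) (c : List (Finset α)) (hc : ∀ J ∈ c, J ≠ ∅ ∧ J ⊆ X) :
    seqMul [X] c = c := by
  induction c with
  | nil => simp [seqMul]
  | cons J t ih =>
    have h := hc J (by simp)
    have ih := ih (fun J hJ => hc J (by simp [hJ]))
    unfold seqMul at ih ⊢
    have h1 : X ∩ J = J := Finset.inter_eq_right.mpr h.2
    simp only [List.map_cons, List.flatten_cons, List.filter_append, h1, List.map_nil] at ih ⊢
    rw [ih]
    simp [h.1]

lemma mem_refi {I B : Finset α} {c : List (Finset α)} (h : B ∈ refi I c) :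
    B ≠ ∅ ∧ ∃ J ∈ c, B ⊆ J := by
  induction c with
  | nil => simp [refi] at h
  | cons J t ih =>
    simp only [refi, List.mem_append, List.mem_filter, List.mem_cons, List.not_mem_nil, or_false,
      decide_eq_true_eq] at h
    rcases h with ⟨h | h, h2⟩ | h
    · exact ⟨h2, J, by simp, h ▸ Finset.inter_subset_left⟩
    · exact ⟨h2, J, by simp, h ▸ Finset.sdiff_subset⟩
    · obtain ⟨h1, J', h2, h3⟩ := ih h
      exact ⟨h1, J', by simp [h2], h3⟩

lemma refi_pure {I : Finset α} {c : List (Finset α)}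
    (h : ∀ J ∈ c, J ≠ ∅ ∧ (J ⊆ I ∨ J ∩ I = ∅)) : refi I c = c := by
  induction c with
  | nil => rfl
  | cons J t ih =>
    rw [refi, ih (fun J hJ => h J (by simp [hJ]))]
    obtain ⟨h0, h1 | h1⟩ := h J (by simp)
    · have h2 : J ∩ I = J := Finset.inter_eq_left.mpr h1
      have h3 : J \ I = ∅ := Finset.sdiff_eq_empty_iff_subset.mpr h1
      simp [h2, h3, h0]
    · have h3 : J \ I = J := by
        exact Finset.sdiff_eq_self_of_disjoint (Finset.disjoint_iff_inter_eq_empty.mpr h1)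
      simp [h1, h3, h0]

lemma refi_tog (T : Set (Finset α)) (I K : Finset α) (c : List (Finset α))
    (hc : ∀ J ∈ c, J ≠ ∅) : refi I (tog T I K c) = refi I c := by
  induction c generalizing K with
  | nil => rfl
  | cons J t ih =>
    have ih := fun K => ih K (fun J hJ => hc J (by simp [hJ]))
    rw [tog]
    split_ifs with h1 h2
    · have e1 : (J ∩ I) \ I = ∅ := by ext; simp
      have e2 : (J \ I) ∩ I = ∅ := by ext; simp
      simp [refi, e1, e2, h1]
    · cases t with
      | nil => simp [MergeC] at h2
      | cons J' t =>
        obtain ⟨⟨ha, hb⟩, -⟩ := h2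
        have n1 := hc J (by simp)
        have n2 := hc J' (by simp)
        have hb' : ∀ x, x ∈ J' → x ∉ I := fun x h h' => by
          have : x ∈ J' ∩ I := by simp [h, h']
          simp [hb] at this
        have e1 : (J ∪ J') ∩ I = J := by ext x; have := @ha x; have := hb' x; simp; tauto
        have e2 : (J ∪ J') \ I = J' := by ext x; have := @ha x; have := hb' x; simp; tauto
        have e3 : J ∩ I = J := Finset.inter_eq_left.mpr ha
        have e4 : J \ I = ∅ := Finset.sdiff_eq_empty_iff_subset.mpr ha
        have e5 : J' \ I = J' := by ext x; have := hb' x; simp; tauto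
        simp [refi, e1, e2, e3, e4, e5, hb, n1, n2]
    · simp [refi, ih]

lemma Ch.ne {X : Finset α} {T : Set (Finset α)} {K : Finset α} {c : List (Finset α)}
    (h : Ch X T K c) : ∀ J ∈ c, J ≠ ∅ := by
  induction c generalizing K with
  | nil => simp
  | cons J t ih =>
    intro J' hJ'
    rcases List.mem_cons.mp hJ' with e | e
    · exact e ▸ h.1
    · exact ih h.2.2.2 J' e

lemma Ch.neX {X : Finset α} {T : Set (Finset α)} (hT : ∀ J ∈ T, J ⊆ X) {K J : Finset α}
    {t : List (Finset α)} (h : Ch X T K (J :: t)) : K ≠ X := by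
  rintro rfl
  obtain ⟨h1, h2, h3, -⟩ := h
  have : K ∪ J ⊆ K := by
    rcases h3 with h3 | h3
    · exact hT _ h3
    · exact h3.le
  apply h1
  have h4 : J ⊆ K := Finset.union_subset_right this
  rwa [Finset.inter_eq_right.mpr h4] at h2

lemma tog_ch {X : Finset α} {T : Set (Finset α)} (I : Finset α)
    {K : Finset α} {c : List (Finset α)}
    (h : Ch X T K c) : Ch X T K (tog T I K c) := by
  induction c generalizing K with
  | nil => exact h
  | cons J t ih =>
    rw [tog]
    obtain ⟨ha, hb, hc, hd⟩ := h
    have hb' : ∀ x, x ∈ K → x ∉ J := fun x h h' => by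
      have : x ∈ K ∩ J := by simp [h, h']
      simp [hb] at this
    split_ifs with h1 h2
    · have e : K ∪ J ∩ I ∪ J \ I = K ∪ J := by ext; simp; tauto
      refine ⟨h1.1, ?_, Or.inl h1.2.2, h1.2.1, ?_, ?_, ?_⟩
      · ext x; have := hb' x; simp; tauto
      · ext x; have := hb' x; simp; tauto
      · rwa [e]
      · rwa [e]
    · cases t with
      | nil => simp [MergeC] at h2
      | cons J' t =>
        obtain ⟨ha2, hb2, hc2, hd2⟩ := hd
        simp only [List.headD_cons, List.tail_cons]
        rw [Finset.union_assoc] at hc2 hd2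
        refine ⟨?_, ?_, hc2, hd2⟩
        · simp [ha]
        · rw [Finset.union_inter_distrib_right, Finset.union_eq_empty] at hb2
          rw [Finset.inter_union_distrib_left, hb, hb2.1]; simp
    · exact ⟨ha, hb, hc, ih hd⟩

lemma tog_merge {T : Set (Finset α)} {I J K : Finset α} {t : List (Finset α)}
    (hn : ∀ J ∈ t, J ≠ ∅) (h : MergeC I J (tog T I K t)) : MergeC I J t := by
  cases t with
  | nil => simp [tog, MergeC] at h
  | cons J' t =>
    rw [tog] at h
    split_ifs at h with h1 h2
    · have := h.2
      simp [Finset.inter_assoc] at this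
      exact absurd this h1.1
    · cases t with
      | nil => simp [MergeC] at h2
      | cons J2 t =>
        have := h.2
        rw [Finset.union_inter_distrib_right, Finset.union_eq_empty,
          Finset.inter_eq_left.mpr h2.1.1] at this
        exact absurd this.1 (hn _ (by simp))
    · exact h

lemma tog_tog {T : Set (Finset α)} {I K : Finset α} {c : List (Finset α)}
    (hn : ∀ J ∈ c, J ≠ ∅) : tog T I K (tog T I K c) = c := by
  induction c generalizing K with
  | nil => rfl
  | cons J t ih =>
    have ih := fun K => @ih K (fun J hJ => hn J (by simp [hJ]))
    rw [tog]
    split_ifs with h1 h2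
    · have e1 : (J ∩ I) \ I = ∅ := by ext; simp
      have e2 : (J \ I) ∩ I = ∅ := by ext; simp
      have e3 : J ∩ I ∪ J \ I = J := by ext; simp; tauto
      rw [tog, if_neg (by simp [e1]), if_pos ⟨⟨Finset.inter_subset_right, e2⟩, h1.2.2⟩]
      simp [e3]
    · cases t with
      | nil => simp [MergeC] at h2
      | cons J' t =>
        obtain ⟨⟨ha, hb⟩, hc⟩ := h2
        have n1 := hn J (by simp)
        have n2 := hn J' (by simp)
        have hb' : ∀ x, x ∈ J' → x ∉ I := fun x h h' => by
          have : x ∈ J' ∩ I := by simp [h, h']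
          simp [hb] at this
        have e1 : (J ∪ J') ∩ I = J := by ext x; have := @ha x; have := hb' x; simp; tauto
        have e2 : (J ∪ J') \ I = J' := by ext x; have := @ha x; have := hb' x; simp; tauto
        simp only [List.headD_cons, List.tail_cons]
        rw [tog, e1, e2, if_pos ⟨n1, n2, hc⟩]
    · rw [tog, if_neg h1, if_neg, ih]
      rintro ⟨h3, h4⟩
      exact h2 ⟨tog_merge (fun J hJ => hn J (by simp [hJ])) h3, h4⟩

lemma tog_length {T : Set (Finset α)} {I K : Finset α} {c : List (Finset α)}
    (h : tog T I K c ≠ c) : (tog T I K c).length = c.length + 1 ∨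
      c.length = (tog T I K c).length + 1 := by
  induction c generalizing K with
  | nil => simp [tog] at h
  | cons J t ih =>
    rw [tog] at h ⊢
    split_ifs at h ⊢ with h1 h2
    · simp
    · cases t with
      | nil => simp [MergeC] at h2
      | cons J' t => simp
    · have := @ih (K ∪ J) (by simpa using h)
      simp only [List.length_cons]; omega

lemma set_aux1 {I K J : Finset α} (hJI : J ⊆ I) : I ∪ (K ∪ J) = I ∪ K := by
  ext x; have := @hJI x; simp; tauto

lemma set_aux2 {I K J : Finset α} : I ∪ (K ∪ J ∩ I) = I ∪ K := by
  ext x; simp; tauto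

lemma set_aux3 {I K B : Finset α} (h3 : B ⊆ K) (h4 : K ∩ I ⊆ B) : K ∩ (I ∪ B) = B := by
  ext x; have := @h3 x; have := @h4 x; simp at this ⊢; tauto

lemma set_aux4 {I K B : Finset α} (h3 : B ⊆ K) : K ∪ (I ∪ B) = I ∪ K := by
  ext x; have := @h3 x; simp; tauto

lemma tog_ne {X : Finset α} {T : Set (Finset α)} {I : Finset α}
    (hT : ∀ J ∈ T, J ⊆ X) (hX : X ∉ T)
    (hc : ∀ A ∈ T, ∀ B ∈ T, A ∩ B ∈ T ∨ A ∪ B ∈ T) (hI : I ∈ T)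
    {K : Finset α} {c : List (Finset α)} (h : Ch X T K c)
    (hinv : (I ∪ K ∈ T ∧ ∀ J t, c = J :: t → J ∩ I ≠ ∅) ∨
      (∃ B, B ∉ T ∧ I ∪ B ∈ T ∧ B ⊆ K ∧ K ∩ I ⊆ B ∧ (K ∈ T ∨ K = X ∨ K = B))) :
    tog T I K c ≠ c := by
  induction c generalizing K with
  | nil =>
    exfalso
    have h : K = X := h
    subst h
    have hIK := hT I hI
    rcases hinv with ⟨h1, -⟩ | ⟨B, h1, h2, h3, h4, -⟩
    · rw [Finset.union_eq_right.mpr hIK] at h1; exact hX h1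
    · rw [Finset.inter_eq_right.mpr hIK] at h4
      rw [Finset.union_eq_right.mpr h4] at h2; exact h1 h2
  | cons J t ih =>
    have hKX := h.neX hT
    obtain ⟨ha, hb, hc', hd⟩ := h
    have hIK : I ∪ K ∈ T := by
      rcases hinv with ⟨h1, -⟩ | ⟨B, h1, h2, h3, h4, h5⟩
      · exact h1
      · rcases h5 with h5 | h5 | h5
        · have e1 : K ∩ (I ∪ B) = B := set_aux3 h3 h4
          have e2 : K ∪ (I ∪ B) = I ∪ K := set_aux4 h3
          have := hc _ h5 _ h2
          rw [e1, e2] at this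
          exact this.resolve_left h1
        · exact absurd h5 hKX
        · rw [h5]; exact h2
    rw [tog]
    split_ifs with h1 h2
    · intro e
      have := congrArg List.length e
      simp at this
    · cases t with
      | nil => simp [MergeC] at h2
      | cons J' t =>
        intro e
        have := congrArg List.length e
        simp at this
    · have key : tog T I (K ∪ J) t ≠ t := by
        apply ih hd
        by_cases hJ : J ∩ I = ∅
        · right
          rcases hinv with ⟨-, h4⟩ | ⟨B, h3, h4, h5, h6, h7⟩
          · exact absurd hJ (h4 J t rfl)
          · refine ⟨B, h3, h4, h5.trans Finset.subset_union_left, ?_, ?_⟩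
            · rw [Finset.union_inter_distrib_right, hJ]; simpa using h6
            · exact hc'.imp_right Or.inl
        · by_cases hJ2 : J \ I = ∅
          · left
            have hJI := Finset.sdiff_eq_empty_iff_subset.mp hJ2
            refine ⟨?_, ?_⟩
            · have e : I ∪ (K ∪ J) = I ∪ K := set_aux1 hJI
              rwa [e]
            · rintro J' t' rfl hJ'
              have hne := hd.neX hT
              exact h2 ⟨⟨hJI, hJ'⟩, hc'.resolve_right hne⟩
          · right
            refine ⟨K ∪ J ∩ I, fun h => h1 ⟨hJ, hJ2, h⟩, ?_, ?_, ?_, ?_⟩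
            · have : I ∪ (K ∪ J ∩ I) = I ∪ K := set_aux2
              rwa [this]
            · exact Finset.union_subset_union_right Finset.inter_subset_left
            · rw [Finset.union_inter_distrib_right]
              exact Finset.union_subset_union_left Finset.inter_subset_left
            · exact hc'.imp_right Or.inl
      simpa using key

lemma ch_iff {X : Finset α} {T : Set (Finset α)} {K : Finset α} {c : List (Finset α)} :
    Ch X T K c ↔ (∀ J ∈ c, J ≠ ∅) ∧ (∀ J ∈ c, K ∩ J = ∅) ∧
      List.Pairwise (fun I J => I ∩ J = ∅) c ∧ K ∪ c.foldr (· ∪ ·) ∅ = X ∧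
      ∀ r : ℕ, 0 < r → r ≤ c.length → (K ∪ ((c.take r).foldr (· ∪ ·) ∅) ∈ T ∨
        K ∪ ((c.take r).foldr (· ∪ ·) ∅) = X) := by
  induction c generalizing K with
  | nil =>
    simp only [Ch, List.not_mem_nil, List.foldr_nil, List.Pairwise.nil, Finset.union_empty]
    constructor
    · intro h
      refine ⟨by simp, by simp, trivial, h, ?_⟩
      intro r h1 h2; simp at h2; omega
    · tauto
  | cons J t ih =>
    rw [Ch, ih]
    simp only [List.forall_mem_cons, List.pairwise_cons, List.foldr_cons,
      Finset.union_inter_distrib_right, Finset.union_eq_empty, Finset.union_assoc]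
    constructor
    · rintro ⟨h1, h2, h3, h4, h5, h6, h7, h8⟩
      refine ⟨⟨h1, h4⟩, ⟨h2, fun J hJ => (h5 J hJ).1⟩, ⟨fun J hJ => (h5 J hJ).2, h6⟩, h7, ?_⟩
      intro r hr hr'
      obtain ⟨r, rfl⟩ : ∃ s, r = s + 1 := ⟨r - 1, by omega⟩
      rcases Nat.eq_zero_or_pos r with rfl | hr0
      · simpa using h3
      · simpa using h8 r hr0 (by simpa using hr')
    · rintro ⟨⟨h1, h4⟩, ⟨h2, h5⟩, ⟨h5', h6⟩, h7, h8⟩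
      refine ⟨h1, h2, ?_, h4, fun J hJ => ⟨h5 J hJ, h5' J hJ⟩, h6, h7, ?_⟩
      · simpa using h8 1 (by simp) (by simp)
      · intro r hr hr'
        simpa using h8 (r + 1) (by simp) (by simpa using hr')

lemma chainFor_iff {X : Finset α} (hX0 : X ≠ ∅) {T : Set (Finset α)} (hT : ∀ J ∈ T, J ⊆ X)
    {c : List (Finset α)} : IsChainFor X T c ↔ Ch X T ∅ c := by
  have hne : ∀ {K c}, Ch X T K c → ∀ r : ℕ, r < c.length →
      K ∪ ((c.take r).foldr (· ∪ ·) ∅) ≠ X := by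
    intro K c
    induction c generalizing K with
    | nil => intro _ r hr; simp at hr
    | cons J t ih =>
      intro h r hr
      cases r with
      | zero => simpa using h.neX hT
      | succ r =>
        have := ih h.2.2.2 r (by simpa using hr)
        simpa [Finset.union_assoc] using this
  constructor
  · rintro ⟨⟨h1, h2, h3, h4⟩, h5⟩
    rw [ch_iff]
    refine ⟨h2, by simp, h3, by simpa using h4, ?_⟩
    intro r hr hr'
    rcases hr'.lt_or_eq with h | rfl
    · left; simpa using h5 r hr h
    · right; simpa using h4
  · intro h
    have h' := h
    rw [ch_iff] at h'
    obtain ⟨h1, h2, h3, h4, h5⟩ := h'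
    refine ⟨⟨?_, h1, h3, by simpa using h4⟩, ?_⟩
    · rintro rfl; simp at h4; exact hX0 h4.symm
    · intro r hr hr'
      have := (h5 r hr hr'.le).resolve_right (hne h r hr')
      simpa using this

/-- The operator `y ↦ (1 - Î) y`. -/
noncomputable def Lop (I : Finset α) : AX α →ₗ[ℂ] AX α :=
  LinearMap.id - Finsupp.lmapDomain ℂ ℂ (refi I)

/-- The product of the operators. -/
noncomputable def Pop : List (Finset α) → (AX α →ₗ[ℂ] AX α)
  | [] => LinearMap.id
  | I :: l => (Lop I).comp (Pop l)

lemma Lop_apply (I : Finset α) (y : AX α) : Lop I y = y - Finsupp.mapDomain (refi I) y := rfl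

/-- Sequences of nonempty subsets of `X`. -/
def goodSet (X : Finset α) : Set (List (Finset α)) := {c | ∀ J ∈ c, J ≠ ∅ ∧ J ⊆ X}

/-- Sequences of nonempty blocks compatible with `K`. -/
def pureSet (K : Finset α) : Set (List (Finset α)) := {c | ∀ J ∈ c, J ≠ ∅ ∧ (J ⊆ K ∨ J ∩ K = ∅)}

lemma refi_good {X I : Finset α} {c} (h : c ∈ goodSet X) : refi I c ∈ goodSet X := by
  intro B hB
  obtain ⟨h1, J, h2, h3⟩ := mem_refi hB
  exact ⟨h1, h3.trans (h J h2).2⟩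

lemma refi_pureSet {K I : Finset α} {c} (h : c ∈ pureSet K) : refi I c ∈ pureSet K := by
  intro B hB
  obtain ⟨h1, J, h2, h3⟩ := mem_refi hB
  refine ⟨h1, ?_⟩
  rcases (h J h2).2 with h4 | h4
  · exact Or.inl (h3.trans h4)
  · right
    have := Finset.inter_subset_inter_right (u := K) h3
    rw [h4] at this
    exact Finset.subset_empty.mp this

lemma Lop_supported {s : Set (List (Finset α))} {I : Finset α} (hs : ∀ c ∈ s, refi I c ∈ s)
    {y : AX α} (hy : y ∈ Finsupp.supported ℂ ℂ s) : Lop I y ∈ Finsupp.supported ℂ ℂ s := by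
  rw [Lop_apply]
  refine Submodule.sub_mem _ hy ?_
  rw [Finsupp.mem_supported] at hy ⊢
  intro c hc
  have := Finsupp.mapDomain_support hc
  obtain ⟨a, ha, rfl⟩ := Finset.mem_image.mp this
  exact hs a (hy ha)

lemma Pop_supported {s : Set (List (Finset α))} (hs : ∀ I, ∀ c ∈ s, refi I c ∈ s)
    (l : List (Finset α))
    {y : AX α} (hy : y ∈ Finsupp.supported ℂ ℂ s) : Pop l y ∈ Finsupp.supported ℂ ℂ s := by
  induction l with
  | nil => exact hy
  | cons I l ih => exact Lop_supported (hs I) ih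

lemma mapDomain_eqOn {s : Set (List (Finset α))} {f : List (Finset α) → List (Finset α)}
    (hs : ∀ c ∈ s, f c = c) {y : AX α} (hy : y ∈ Finsupp.supported ℂ ℂ s) :
    Finsupp.mapDomain f y = y := by
  rw [Finsupp.mem_supported] at hy
  conv_rhs => rw [← Finsupp.mapDomain_id (v := y)]
  exact Finsupp.mapDomain_congr fun c hc => hs c (hy hc)

lemma Pop_pure {K : Finset α} {l : List (Finset α)} (hK : K ∈ l) {y : AX α}
    (hy : y ∈ Finsupp.supported ℂ ℂ (pureSet K)) : Pop l y = 0 := by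
  induction l with
  | nil => simp at hK
  | cons I l ih =>
    change Lop I (Pop l y) = 0
    by_cases h : K ∈ l
    · rw [ih h, map_zero]
    · obtain rfl : K = I := by simpa [h] using hK
      have := Pop_supported (fun I c => refi_pureSet (K := K) (I := I)) l hy
      rw [Lop_apply, mapDomain_eqOn (fun c hc => refi_pure hc) this, sub_self]

lemma Pop_fix {l : List (Finset α)} {y : AX α}
    (h : ∀ I ∈ l, Finsupp.mapDomain (refi I) y = 0) : Pop l y = y := by
  induction l with
  | nil => rfl
  | cons I l ih =>
    change Lop I (Pop l y) = y
    rw [ih (fun I hI => h I (by simp [hI])), Lop_apply, h I (by simp), sub_zero]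

lemma amul_eq {X I : Finset α} {y : AX α} (hy : y ∈ Finsupp.supported ℂ ℂ (goodSet X)) :
    amul (oneA X - hatI X I) y = Lop I y := by
  have h1 : amul (oneA X - hatI X I) y = Finsupp.mapDomain (seqMul [X]) y
      - Finsupp.mapDomain (seqMul [I, X \ I]) y := by
    unfold amul
    rw [Finsupp.sum_sub_index]
    · unfold oneA hatI
      rw [Finsupp.sum_single_index, Finsupp.sum_single_index]
      · simp only [one_mul]; rfl
      · simp only [zero_mul, Finsupp.single_zero, Finsupp.sum_fun_zero]
      · simp only [zero_mul, Finsupp.single_zero, Finsupp.sum_fun_zero]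
    · intro a b1 b2
      simp [Finsupp.sum, sub_mul, Finset.sum_sub_distrib]
  rw [h1, mapDomain_eqOn (fun c hc => seqMul_one X c hc) hy, Lop_apply]
  congr 1
  rw [Finsupp.mem_supported] at hy
  exact Finsupp.mapDomain_congr fun c hc => seqMul_eq_refi X I c fun J hJ => (hy hc J hJ).2

lemma aprod_eq {X : Finset α} (hX : X ≠ ∅) (l : List (Finset α)) :
    aprod X (l.map fun I => oneA X - hatI X I) = Pop l (oneA X) := by
  have h0 : oneA X ∈ Finsupp.supported ℂ ℂ (goodSet X) := by
    unfold oneA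
    apply Finsupp.single_mem_supported
    intro J hJ
    simp at hJ
    subst hJ
    exact ⟨hX, subset_rfl⟩
  induction l with
  | nil => rfl
  | cons I l ih =>
    change amul (oneA X - hatI X I) (aprod X (l.map fun I => oneA X - hatI X I)) = _
    rw [ih, amul_eq (Pop_supported (fun I c => refi_good) l h0)]
    rfl

lemma US_apply [Fintype α] (X : Finset α) (T : Set (Finset α)) (c : List (Finset α)) :
    US X T c = if IsChainFor X T c then (-1 : ℂ) ^ (c.length - 1) else 0 := rfl

lemma US_support [Fintype α] (X : Finset α) (T : Set (Finset α)) (c : List (Finset α)) :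
    c ∈ (US X T).support ↔ IsChainFor X T c := by
  rw [Finsupp.mem_support_iff, US_apply]
  split_ifs with h <;> simp [h]

lemma refi_US [Fintype α] {X : Finset α} {T : Set (Finset α)} {I : Finset α} (hX0 : X ≠ ∅)
    (hT : ∀ J ∈ T, J ⊆ X) (hX : X ∉ T) (h0 : ∅ ∉ T)
    (hc : ∀ A ∈ T, ∀ B ∈ T, A ∩ B ∈ T ∨ A ∪ B ∈ T) (hI : I ∈ T) :
    Finsupp.mapDomain (refi I) (US X T) = 0 := by
  have hch : ∀ c, c ∈ (US X T).support ↔ Ch X T ∅ c := fun c => by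
    rw [US_support, chainFor_iff hX0 hT]
  have hne : ∀ c, Ch X T ∅ c → tog T I ∅ c ≠ c := fun c h =>
    tog_ne hT hX hc hI h (Or.inr ⟨∅, h0, by simpa using hI, by simp, by simp, by simp⟩)
  unfold Finsupp.mapDomain Finsupp.sum
  refine Finset.sum_involution (fun c _ => tog T I ∅ c) ?_ ?_ ?_ ?_
  · intro c h
    have h1 := (hch c).mp h
    have h2 := tog_ch I h1
    beta_reduce
    rw [refi_tog T I ∅ c h1.ne, US_apply, US_apply, if_pos ((chainFor_iff hX0 hT).mpr h1),
      if_pos ((chainFor_iff hX0 hT).mpr h2), ← Finsupp.single_add]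
    have p1 : 0 < c.length := List.length_pos_iff.mpr ((chainFor_iff hX0 hT).mpr h1).1.1
    have p2 : 0 < (tog T I ∅ c).length :=
      List.length_pos_iff.mpr ((chainFor_iff hX0 hT).mpr h2).1.1
    rw [Finsupp.single_eq_zero]
    rcases tog_length (hne c h1) with e | e
    · have : (tog T I ∅ c).length - 1 = (c.length - 1) + 1 := by omega
      rw [this, pow_succ]; ring
    · have : c.length - 1 = ((tog T I ∅ c).length - 1) + 1 := by omega
      rw [this, pow_succ]; ring
  · intro c h _
    exact hne c ((hch c).mp h)
  · intro c h
    exact (hch _).mpr (tog_ch I ((hch c).mp h))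
  · intro c h
    exact tog_tog ((hch c).mp h).ne

lemma US_sub_one [Fintype α] {X : Finset α} {T : Set (Finset α)} (hX0 : X ≠ ∅) {c}
    (h : (US X T - oneA X) c ≠ 0) : ∃ K ∈ T, c ∈ pureSet K := by
  rw [Finsupp.sub_apply, US_apply] at h
  have hXc : IsChainFor X T [X] := by
    refine ⟨⟨by simp, by simpa using hX0, by simp, by simp⟩, ?_⟩
    intro r h1 h2; simp at h2; omega
  have hcX : c ≠ [X] := by
    rintro rfl
    rw [if_pos hXc] at h
    simp [oneA] at h
  have e : (oneA X) c = 0 := by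
    unfold oneA; rw [Finsupp.single_apply, if_neg (Ne.symm hcX)]
  rw [e] at h
  have hc : IsChainFor X T c := by
    by_contra hc; simp [hc] at h
  obtain ⟨⟨h1, h2, h3, h4⟩, h5⟩ := hc
  match c, h1 with
  | [J], _ => simp at h4; exact absurd (by rw [h4]) hcX
  | J :: J' :: t, _ =>
    refine ⟨J, by simpa using h5 1 (by simp) (by simp), ?_⟩
    intro B hB
    refine ⟨h2 B hB, ?_⟩
    rcases List.mem_cons.mp hB with rfl | hB
    · exact Or.inl subset_rfl
    · right
      rw [Finset.inter_comm]
      exact (List.pairwise_cons.mp h3).1 B hB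


/-- `U_S = (1−Î_1)⋯(1−Î_N)` for any enumeration `I_1,…,I_N` of the opposite
paracell `S'`. -/
theorem US_eq_prod {α : Type*} [DecidableEq α] [Fintype α] (X : Finset α)
    (hX : 2 ≤ X.card) (S : Set (Finset α)) (hS : IsParacell X S)
    (l : List (Finset α)) (hnd : l.Nodup)
    (hmem : ∀ I : Finset α, I ∈ l ↔ I ∈ opp X S) :
    US X (opp X S) = aprod X (l.map fun I => oneA X - hatI X I) := by
  have hX0 : X ≠ ∅ := by rintro rfl; simp at hX
  obtain ⟨-, hp, hcl⟩ := hS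
  have hT : ∀ J ∈ opp X S, J ⊆ X := fun J hJ => hJ.1
  have hXT : X ∉ opp X S := fun h => (hp _ h.2).2.1 (by simp)
  have h0T : ∅ ∉ opp X S := fun h => (hp _ h.2).2.2 (by simp)
  have hc : ∀ A ∈ opp X S, ∀ B ∈ opp X S, A ∩ B ∈ opp X S ∨ A ∪ B ∈ opp X S := by
    rintro A ⟨hA, hA'⟩ B ⟨hB, hB'⟩
    rcases hcl _ hA' _ hB' with h | h
    · right
      refine ⟨Finset.union_subset hA hB, ?_⟩
      rwa [Finset.sdiff_union_distrib]
    · left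
      refine ⟨Finset.inter_subset_left.trans hA, ?_⟩
      have e : X \ (A ∩ B) = (X \ A) ∪ (X \ B) := by ext; simp; tauto
      rwa [e]
  rw [aprod_eq hX0]
  have h1 : Pop l (US X (opp X S)) = US X (opp X S) :=
    Pop_fix fun I hI => refi_US hX0 hT hXT h0T hc ((hmem I).mp hI)
  have h2 : Pop l (US X (opp X S) - oneA X) = 0 := by
    rw [← Finsupp.sum_single (US X (opp X S) - oneA X), Finsupp.sum, map_sum]
    refine Finset.sum_eq_zero fun c hc => ?_
    obtain ⟨K, hK, hcK⟩ := US_sub_one hX0 (Finsupp.mem_support_iff.mp hc)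
    exact Pop_pure ((hmem K).mpr hK) (Finsupp.single_mem_supported ℂ _ hcK)
  rw [map_sub, h1, sub_eq_zero] at h2
  exact h2


end GRF
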